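/- Let F be a γ-pliable set family on a finite set V, let I be an inclusion-minimal cover of F such that every edge of I covers some F-core, let U be the union of all F-cores, let L be a laminar witness family for I augmented with V, let (S₀, S₁, …, S_ℓ) be a hollow chain in L, and for each i let a_i b_i be the unique edge of I covering S_i with a_i ∈ S_i. If b_j ∈ U for some 0 ≤ j ≤ ℓ, then ℓ ≤ j + 2, and if ℓ = j + 2 then b_j, b_{j+1}, a_{j+2} all belong to the same F-core. -/

import Mathlib

open scoped Classical

namespace SFEC

variable {V : Type*}

/-- An edge (an unordered pair of distinct elements) `e` covers a set `S`
if exactly one endpoint of `e` lies in `S`. -/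
def Covers (e : Sym2 V) (S : Set V) : Prop :=
  ∃ u v : V, e = s(u, v) ∧ u ∈ S ∧ v ∉ S

/-- `delta I S` is the set of edges of `I` with exactly one endpoint in `S`. -/
noncomputable def delta (I : Finset (Sym2 V)) (S : Set V) : Finset (Sym2 V) :=
  I.filter (fun e => Covers e S)

/-- `d I S = |delta I S|`. -/
noncomputable def d (I : Finset (Sym2 V)) (S : Set V) : ℕ := (delta I S).card

/-- A set family on `V`: a collection of subsets with `∅ ∉ F` and `V ∉ F`. -/
def IsSetFamily (F : Set (Set V)) : Prop := ∅ ∉ F ∧ Set.univ ∉ F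

/-- `I` covers the family `F` if it covers every member of `F`. -/
def CoversFam (I : Finset (Sym2 V)) (F : Set (Set V)) : Prop := ∀ S ∈ F, 1 ≤ d I S

/-- `I` is an inclusion-minimal cover of `F`. -/
def MinimalCover (I : Finset (Sym2 V)) (F : Set (Set V)) : Prop :=
  CoversFam I F ∧ ∀ J : Finset (Sym2 V), J ⊂ I → ¬ CoversFam J F

/-- At least two of the four statements hold. -/
def AtLeastTwo (p q r s : Prop) : Prop :=
  (p ∧ q) ∨ (p ∧ r) ∨ (p ∧ s) ∨ (q ∧ r) ∨ (q ∧ s) ∨ (r ∧ s)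

/-- A family is pliable if for all `A, B ∈ F` at least two of the four sets
`A ∩ B, A ∪ B, A \ B, B \ A` belong to `F`. -/
def Pliable (F : Set (Set V)) : Prop :=
  ∀ A ∈ F, ∀ B ∈ F, AtLeastTwo (A ∩ B ∈ F) (A ∪ B ∈ F) (A \ B ∈ F) (B \ A ∈ F)

/-- The residual family `F^I`: the members of `F` covered by no edge of `I`. -/
def Residual (F : Set (Set V)) (I : Finset (Sym2 V)) : Set (Set V) := {S ∈ F | d I S = 0}

/-- `A` and `B` cross if `A ∩ B`, `A \ B`, `B \ A` and `V \ (A ∪ B)` are all nonempty. -/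
def Crosses (A B : Set V) : Prop :=
  (A ∩ B).Nonempty ∧ (A \ B).Nonempty ∧ (B \ A).Nonempty ∧ ((A ∪ B)ᶜ : Set V).Nonempty

/-- An `F`-core: an inclusion-minimal member of `F`. -/
def Core (F : Set (Set V)) (C : Set V) : Prop := C ∈ F ∧ ∀ A ∈ F, A ⊆ C → A = C

/-- Property (γ). -/
def PropertyGamma (F : Set (Set V)) : Prop :=
  ∀ (J : Finset (Sym2 V)) (S₁ S₂ C : Set V),
    S₁ ∈ Residual F J → S₂ ∈ Residual F J → S₁ ⊂ S₂ →
    Core (Residual F J) C → Crosses C S₁ → Crosses C S₂ →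
    S₂ \ (S₁ ∪ C) = ∅ ∨ S₂ \ (S₁ ∪ C) ∈ Residual F J

/-- `F` is γ-pliable: pliable and satisfying Property (γ). -/
def GammaPliable (F : Set (Set V)) : Prop := Pliable F ∧ PropertyGamma F

/-- `S` is a witness set for the edge `e ∈ I` if `δ_I(S) = {e}`. -/
def WitnessSet (F : Set (Set V)) (I : Finset (Sym2 V)) (S : Set V) (e : Sym2 V) : Prop :=
  S ∈ F ∧ delta I S = {e}

/-- `L ⊆ F` is a witness family for `I`: `|L| = |I|` and each `e ∈ I` has a witness set in `L`. -/
def WitnessFamily (F : Set (Set V)) (I : Finset (Sym2 V)) (L : Finset (Set V)) : Prop :=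
  ↑L ⊆ F ∧ L.card = I.card ∧ ∀ e ∈ I, ∃ S ∈ L, WitnessSet F I S e

/-- A family is laminar if any two members are disjoint or one contains the other. -/
def Laminar (L : Finset (Set V)) : Prop :=
  ∀ A ∈ L, ∀ B ∈ L, A ⊆ B ∨ B ⊆ A ∨ Disjoint A B

/-- `S ∈ L` owns `C` if `S` is the inclusion-minimal member of `L` containing `C`. -/
def Owns (L : Finset (Set V)) (S C : Set V) : Prop :=
  S ∈ L ∧ C ⊆ S ∧ ∀ T ∈ L, C ⊆ T → S ⊆ T

/-- `S ∈ L` is hollow if it owns no `F`-core. -/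
def Hollow (F : Set (Set V)) (L : Finset (Set V)) (S : Set V) : Prop :=
  S ∈ L ∧ ∀ C : Set V, Core F C → ¬ Owns L S C

/-- `A` is the unique child of `S` in `L`: the unique maximal member of `L`
properly contained in `S`. -/
def UniqueChild (L : Finset (Set V)) (A S : Set V) : Prop :=
  A ∈ L ∧ A ⊂ S ∧ ∀ B ∈ L, B ⊂ S → B ⊆ A

/-- `(S 0, S 1, …, S ℓ)` is a hollow chain in `L`. -/
def HollowChain (F : Set (Set V)) (L : Finset (Set V)) (S : ℕ → Set V) (ℓ : ℕ) : Prop :=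
  (∀ i ≤ ℓ, S i ∈ L) ∧
  (∀ i, 1 ≤ i → i ≤ ℓ → Hollow F L (S i)) ∧
  S ℓ ≠ Set.univ ∧
  (∀ i, 1 ≤ i → i ≤ ℓ → UniqueChild L (S (i - 1)) (S i))

/-- `U`: the union of all `F`-cores. -/
def coreUnion (F : Set (Set V)) : Set V := ⋃₀ {C | Core F C}

/-- `F` is uncrossable. -/
def Uncrossable (F : Set (Set V)) : Prop :=
  ∀ A ∈ F, ∀ B ∈ F, (A ∩ B ∈ F ∧ A ∪ B ∈ F) ∨ (A \ B ∈ F ∧ B \ A ∈ F)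

/-- `F` is semi-uncrossable. -/
def SemiUncrossable (F : Set (Set V)) : Prop :=
  ∀ A ∈ F, ∀ B ∈ F,
    (A ∩ B ∈ F ∧ (A ∪ B ∈ F ∨ A \ B ∈ F ∨ B \ A ∈ F)) ∨ (A \ B ∈ F ∧ B \ A ∈ F)

end SFEC

open SFEC

namespace SFEC

variable {V : Type*}

theorem residual_empty (F : Set (Set V)) : Residual F ∅ = F := by
  ext S
  simp [Residual, d, delta]

theorem exists_core_subset [Finite V] {F : Set (Set V)} {A : Set V} (hA : A ∈ F) :
    ∃ C, Core F C ∧ C ⊆ A := by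
  obtain ⟨C, hCA, hC⟩ := (Set.toFinite F).exists_le_minimal hA
  exact ⟨C, ⟨hC.prop, fun B hB hBC => hBC.antisymm (hC.le_of_le hB hBC)⟩, hCA⟩

/-- Two cores of a pliable family that share an element are equal. -/
theorem Core.eq_of_mem {F : Set (Set V)} (hF : Pliable F) {C D : Set V}
    (hC : Core F C) (hD : Core F D) {x : V} (hxC : x ∈ C) (hxD : x ∈ D) : C = D := by
  have hinter : C ∩ D ∈ F → C = D := fun h =>
    (hC.2 _ h Set.inter_subset_left).symm.trans (hD.2 _ h Set.inter_subset_right)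
  have hCD : C \ D ∉ F := fun h => ((hC.2 _ h Set.sdiff_subset).symm ▸ hxC : x ∈ C \ D).2 hxD
  have hDC : D \ C ∉ F := fun h => ((hD.2 _ h Set.sdiff_subset).symm ▸ hxD : x ∈ D \ C).2 hxC
  have := hF C hC.1 D hD.1
  unfold AtLeastTwo at this
  tauto

/-- A core meeting a member of a pliable family without lying inside it crosses that member. -/
theorem Core.crosses {F : Set (Set V)} (hF : IsSetFamily F) (hp : Pliable F) {C S : Set V}
    (hC : Core F C) (hS : S ∈ F) (hmeet : (C ∩ S).Nonempty) (hsub : ¬ C ⊆ S) :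
    Crosses C S := by
  have hinter : C ∩ S ∉ F := fun h =>
    hsub (Set.inter_eq_left.mp (hC.2 _ h Set.inter_subset_left))
  have hdiff : C \ S ∉ F := fun h => by
    obtain ⟨x, hxC, hxS⟩ := hmeet
    exact ((hC.2 _ h Set.sdiff_subset).symm ▸ hxC : x ∈ C \ S).2 hxS
  have hboth : C ∪ S ∈ F ∧ S \ C ∈ F := by
    have := hp C hC.1 S hS
    unfold AtLeastTwo at this
    tauto
  refine ⟨hmeet, Set.sdiff_nonempty.mpr hsub, ?_, ?_⟩
  · rw [Set.nonempty_iff_ne_empty]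
    exact fun h => hF.1 (h ▸ hboth.2)
  · rw [Set.nonempty_compl]
    exact fun h => hF.2 (h ▸ hboth.1)

theorem Laminar.insert_univ {L : Finset (Set V)} (hL : Laminar L) :
    Laminar (insert Set.univ L) := by
  intro A hA B hB
  rcases Finset.mem_insert.mp hA with rfl | hA
  · exact .inr (.inl (Set.subset_univ _))
  rcases Finset.mem_insert.mp hB with rfl | hB
  · exact .inl (Set.subset_univ _)
  exact hL A hA B hB

theorem Laminar.exists_owns {L : Finset (Set V)} (hL : Laminar L) {C A : Set V}
    (hC : C.Nonempty) (hA : A ∈ L) (hCA : C ⊆ A) : ∃ T, Owns L T C := by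
  obtain ⟨T, hT⟩ := (L.filter (C ⊆ ·)).exists_minimal ⟨A, by simp [hA, hCA]⟩
  have hTL := Finset.mem_filter.mp hT.prop
  refine ⟨T, hTL.1, hTL.2, fun B hB hCB => ?_⟩
  rcases hL T hTL.1 B hB with h | h | h
  · exact h
  · exact hT.le_of_le (Finset.mem_filter.mpr ⟨hB, hCB⟩) h
  · obtain ⟨x, hx⟩ := hC
    exact (Set.disjoint_left.mp h (hTL.2 hx) (hCB hx)).elim

theorem Hollow.core_subset_child {F : Set (Set V)} (hF : IsSetFamily F) {L : Finset (Set V)}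
    (hL : Laminar L) {A S C : Set V} (hS : Hollow F L S) (hA : UniqueChild L A S)
    (hC : Core F C) (hCS : C ⊆ S) : C ⊆ A := by
  have hne : C.Nonempty := Set.nonempty_iff_ne_empty.mpr fun h => hF.1 (h ▸ hC.1)
  obtain ⟨T, hT⟩ := hL.exists_owns hne hS.1 hCS
  have hTS : T ≠ S := fun h => hS.2 C hC (h ▸ hT)
  exact hT.2.1.trans (hA.2.2 T hT.1 ((hT.2.2 S hS.1 hCS).ssubset_of_ne hTS))

theorem HollowChain.core_subset_zero {F : Set (Set V)} (hF : IsSetFamily F)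
    {L : Finset (Set V)} (hL : Laminar L) {S : ℕ → Set V} {n : ℕ} (h : HollowChain F L S n)
    {C : Set V} (hC : Core F C) {i : ℕ} (hi : i ≤ n) (hCS : C ⊆ S i) : C ⊆ S 0 := by
  induction i with
  | zero => exact hCS
  | succ k ih =>
    exact ih (by omega) ((h.2.1 (k + 1) (by omega) hi).core_subset_child hF hL
      (h.2.2.2 (k + 1) (by omega) hi) hC hCS)

theorem HollowChain.ssubset_succ {F : Set (Set V)} {L : Finset (Set V)} {S : ℕ → Set V}
    {n : ℕ} (h : HollowChain F L S n) {i : ℕ} (hi : i < n) : S i ⊂ S (i + 1) :=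
  (h.2.2.2 (i + 1) (by omega) hi).2.1

theorem HollowChain.subset {F : Set (Set V)} {L : Finset (Set V)} {S : ℕ → Set V}
    {n : ℕ} (h : HollowChain F L S n) {i k : ℕ} (hik : i ≤ k) (hk : k ≤ n) : S i ⊆ S k := by
  induction k, hik using Nat.le_induction with
  | base => exact subset_rfl
  | succ k hik ih => exact (ih (by omega)).trans (h.ssubset_succ hk).subset

theorem HollowChain.mem_of_insert_univ {F : Set (Set V)} {L : Finset (Set V)}
    {S : ℕ → Set V} {n : ℕ} (h : HollowChain F (insert Set.univ L) S n) {i : ℕ} (hi : i ≤ n) :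
    S i ∈ L :=
  (Finset.mem_insert.mp (h.1 i hi)).resolve_left fun hu =>
    h.2.2.1 (Set.univ_subset_iff.mp (hu ▸ h.subset hi le_rfl))

theorem WitnessFamily.eq_of_delta_eq {F : Set (Set V)} {I : Finset (Sym2 V)}
    {L : Finset (Set V)} (h : WitnessFamily F I L) {A B : Set V} (hA : A ∈ L) (hB : B ∈ L)
    (hAB : delta I A = delta I B) : A = B := by
  choose f hfL hf using h.2.2
  have hsurj := Finset.surj_on_of_inj_on_of_card_le f hfL
    (fun e e' he he' heq => by
      have := (hf e he).2.symm.trans (heq ▸ (hf e' he').2)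
      exact Finset.singleton_injective this) h.2.1.le
  obtain ⟨e, he, rfl⟩ := hsurj A hA
  obtain ⟨e', he', rfl⟩ := hsurj B hB
  rw [(hf e he).2, (hf e' he').2] at hAB
  obtain rfl := Finset.singleton_injective hAB
  rfl

theorem Covers.of_mem_of_notMem {S : Set V} {u v : V} (hu : u ∈ S) (hv : v ∉ S) :
    Covers s(u, v) S := ⟨u, v, rfl, hu, hv⟩

theorem covers_mk_iff {S : Set V} {u v : V} :
    Covers s(u, v) S ↔ (u ∈ S ∧ v ∉ S) ∨ (v ∈ S ∧ u ∉ S) := by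
  constructor
  · rintro ⟨x, y, hxy, hx, hy⟩
    rcases Sym2.eq_iff.mp hxy with ⟨rfl, rfl⟩ | ⟨rfl, rfl⟩
    · exact .inl ⟨hx, hy⟩
    · exact .inr ⟨hx, hy⟩
  · rintro (⟨hu, hv⟩ | ⟨hv, hu⟩)
    · exact .of_mem_of_notMem hu hv
    · exact Sym2.eq_swap ▸ .of_mem_of_notMem hv hu

/-- If a core crosses two nested members of a γ-pliable family and the outer one contains
no core outside the inner one, then the core contains their difference. -/
theorem PropertyGamma.sdiff_subset_core [Finite V] {F : Set (Set V)} (hg : PropertyGamma F)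
    {A B C : Set V} (hA : A ∈ F) (hB : B ∈ F) (hAB : A ⊂ B) (hC : Core F C)
    (hCA : Crosses C A) (hCB : Crosses C B) (hcore : ∀ D, Core F D → ¬ D ⊆ B \ (A ∪ C)) :
    B \ A ⊆ C := by
  have hor := hg ∅ A B C
  simp only [residual_empty] at hor
  rcases hor hA hB hAB hC hCA hCB with h | h
  · rintro x ⟨hxB, hxA⟩
    by_contra hxC
    exact Set.notMem_empty x (h ▸ ⟨hxB, fun hx => hx.elim hxA hxC⟩)
  · obtain ⟨D, hD, hDs⟩ := exists_core_subset h
    exact (hcore D hD hDs).elim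

end SFEC

theorem stmt_11
    {V : Type*} [Fintype V]
    (F : Set (Set V)) (hF : IsSetFamily F) (hgp : GammaPliable F)
    (I : Finset (Sym2 V)) (hIe : ∀ e ∈ I, ¬ e.IsDiag)
    (hmin : MinimalCover I F)
    (hcov : ∀ e ∈ I, ∃ C : Set V, Core F C ∧ Covers e C)
    (L : Finset (Set V)) (hWF : WitnessFamily F I L) (hlam : Laminar L)
    (S : ℕ → Set V) (ℓ : ℕ)
    (hchain : HollowChain F (insert Set.univ L) S ℓ)
    (a b : ℕ → V)
    (hedge : ∀ i ≤ ℓ, s(a i, b i) ∈ I ∧ a i ∈ S i ∧ b i ∉ S i ∧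
      delta I (S i) = {s(a i, b i)})
    (j : ℕ) (hjℓ : j ≤ ℓ)
    (hbU : b j ∈ coreUnion F) :
    ℓ ≤ j + 2 ∧ (ℓ = j + 2 →
      ∃ C : Set V, Core F C ∧ b j ∈ C ∧ b (j + 1) ∈ C ∧ a (j + 2) ∈ C) := by
  have hlam' := hlam.insert_univ
  have hL : ∀ i ≤ ℓ, S i ∈ L := fun i hi => hchain.mem_of_insert_univ hi
  have hSF : ∀ i ≤ ℓ, S i ∈ F := fun i hi => hWF.1 (hL i hi)
  have hdelta : ∀ k, k < ℓ → delta I (S k) ≠ delta I (S (k + 1)) := fun k hk h =>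
    (hchain.ssubset_succ hk).ne (hWF.eq_of_delta_eq (hL k hk.le) (hL (k + 1) hk) h)
  have hb : ∀ k, k < ℓ → b k ∈ S (k + 1) := by
    intro k hk
    by_contra hbk
    obtain ⟨heI, hak, -, hd⟩ := hedge k hk.le
    have hd' := (hedge (k + 1) hk).2.2.2
    have hmem : s(a k, b k) ∈ delta I (S (k + 1)) := Finset.mem_filter.mpr
      ⟨heI, .of_mem_of_notMem ((hchain.ssubset_succ hk).subset hak) hbk⟩
    rw [hd', Finset.mem_singleton] at hmem
    exact hdelta k hk (by rw [hd, hd', hmem])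
  have ha : ∀ k, k < ℓ → a (k + 1) ∉ S k := by
    intro k hk hak
    obtain ⟨heI, -, hbk, hd'⟩ := hedge (k + 1) hk
    have hd := (hedge k hk.le).2.2.2
    have hmem : s(a (k + 1), b (k + 1)) ∈ delta I (S k) := Finset.mem_filter.mpr
      ⟨heI, .of_mem_of_notMem hak fun h => hbk ((hchain.ssubset_succ hk).subset h)⟩
    rw [hd, Finset.mem_singleton] at hmem
    exact hdelta k hk (by rw [hd, hd', hmem])
  obtain ⟨C, hC, hbC⟩ := hbU
  replace hC : Core F C := hC
  have hCsub : ∀ k ≤ ℓ, ¬ C ⊆ S k := fun k hk h =>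
    (hedge j hjℓ).2.2.1 (hchain.subset (Nat.zero_le j) hjℓ
      (hchain.core_subset_zero hF hlam' hC hk h hbC))
  have hcross : ∀ k, j < k → k ≤ ℓ → Crosses C (S k) := fun k hjk hk =>
    hC.crosses hF hgp.1 (hSF k hk)
      ⟨b j, hbC, hchain.subset hjk hk (hb j (by omega))⟩ (hCsub k hk)
  have hfill : ∀ k, j < k → k < ℓ → S (k + 1) \ S k ⊆ C := by
    intro k hjk hk
    refine hgp.2.sdiff_subset_core (hSF k hk.le) (hSF (k + 1) hk) (hchain.ssubset_succ hk) hC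
      (hcross k hjk hk.le) (hcross (k + 1) (by omega) hk) fun D hD hDs => ?_
    obtain ⟨x, hx⟩ : D.Nonempty := Set.nonempty_iff_ne_empty.mpr fun h => hF.1 (h ▸ hD.1)
    exact (hDs hx).2 (.inl (hchain.subset (Nat.zero_le k) hk.le
      (hchain.core_subset_zero hF hlam' hD hk (hDs.trans Set.sdiff_subset) hx)))
  have hbfill : ∀ k, j < k → k < ℓ → b k ∈ C := fun k hjk hk =>
    hfill k hjk hk ⟨hb k hk, (hedge k hk.le).2.2.1⟩
  have hafill : ∀ k, j < k → k < ℓ → a (k + 1) ∈ C := fun k hjk hk =>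
    hfill k hjk hk ⟨(hedge (k + 1) hk).2.1, ha k hk⟩
  refine ⟨?_, fun hℓ => ⟨C, hC, hbC, hbfill (j + 1) (by omega) (by omega),
    hafill (j + 1) (by omega) (by omega)⟩⟩
  by_contra hlt
  have haC : a (j + 2) ∈ C := hafill (j + 1) (by omega) (by omega)
  have hbC' : b (j + 2) ∈ C := hbfill (j + 2) (by omega) (by omega)
  obtain ⟨D, hD, hcovD⟩ := hcov _ (hedge (j + 2) (by omega)).1
  rcases covers_mk_iff.mp hcovD with ⟨hin, hout⟩ | ⟨hin, hout⟩
  · exact hout (hC.eq_of_mem hgp.1 hD haC hin ▸ hbC')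
  · exact hout (hC.eq_of_mem hgp.1 hD hbC' hin ▸ haC)
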